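/- For every real x > 0 there exists ν > 0 such that for all real y > ν, the Beta function satisfies B(x,y) ≤ 2·Γ(x)·y^{−x}, where B(x,y) = Γ(x)Γ(y)/Γ(x+y). -/

import Mathlib

/-- The real Beta function `B(a,b) = Γ(a)Γ(b)/Γ(a+b)`. -/
noncomputable def realBeta (a b : ℝ) : ℝ :=
  Real.Gamma a * Real.Gamma b / Real.Gamma (a + b)

/-- **Eventual Beta-function bound:** for every real `x > 0` there is `ν > 0` such that
`B(x,y) ≤ 2·Γ(x)·y^{−x}` for all `y > ν`. -/
theorem beta_eventually_le (x : ℝ) (hx : 0 < x) :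
    ∃ ν : ℝ, 0 < ν ∧ ∀ y : ℝ, ν < y → realBeta x y ≤ 2 * Real.Gamma x * y ^ (-x) := by
  obtain ⟨c, hc0, hc1, hcx⟩ : ∃ c : ℝ, 0 < c ∧ c < 1 ∧ c ^ x = 1 / 2 := by
    refine ⟨(1 / 2 : ℝ) ^ (1 / x), by positivity, ?_, ?_⟩
    · exact Real.rpow_lt_one (by norm_num) (by norm_num) (by positivity)
    · rw [← Real.rpow_mul (by norm_num), one_div_mul_cancel hx.ne', Real.rpow_one]
  have h1c : 0 < 1 - c := by linarith
  refine ⟨1 / (1 - c), by positivity, fun y hy => ?_⟩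
  rw [div_lt_iff₀ h1c] at hy
  have hy1 : 1 < y := by nlinarith
  have hy0 : 0 < y := by linarith
  have hG := Real.Gamma_pos_of_pos hy0
  have hGx := Real.Gamma_pos_of_pos hx
  have hGxy := Real.Gamma_pos_of_pos (add_pos hx hy0)
  have hG1 := Real.Gamma_pos_of_pos (sub_pos.2 hy1)
  have hs := Real.convexOn_log_Gamma.slope_mono_adjacent (x := y - 1) (y := y) (z := x + y)
    (by simpa using hy1) (by simp; linarith) (by linarith) (by linarith)
  have hrec : Real.Gamma y = (y - 1) * Real.Gamma (y - 1) := by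
    have := Real.Gamma_add_one (s := y - 1) (by linarith)
    simpa using this
  simp only [Function.comp] at hs
  have hl : Real.log (Real.Gamma y) = Real.log (y - 1) + Real.log (Real.Gamma (y - 1)) := by
    rw [hrec, Real.log_mul (by linarith) hG1.ne']
  have e1 : y - (y - 1) = 1 := by ring
  have e2 : x + y - y = x := by ring
  rw [e1, e2, div_one, le_div_iff₀ hx] at hs
  have hs2 : Real.log (y - 1) * x + Real.log (Real.Gamma y) ≤ Real.log (Real.Gamma (x + y)) := by
    have : Real.log (Real.Gamma y) - Real.log (Real.Gamma (y - 1)) = Real.log (y - 1) := by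
      linarith
    rw [this] at hs
    linarith
  have hmain : (y - 1) ^ x * Real.Gamma y ≤ Real.Gamma (x + y) := by
    have := Real.exp_le_exp.2 hs2
    rwa [Real.exp_add, Real.exp_log hG, Real.exp_log hGxy,
      ← Real.rpow_def_of_pos (by linarith)] at this
  have hp : 1 / 2 * y ^ x ≤ (y - 1) ^ x := by
    rw [← hcx, ← Real.mul_rpow hc0.le hy0.le]
    exact Real.rpow_le_rpow (by positivity) (by nlinarith) hx.le
  have hyx : 0 < y ^ x := by positivity
  unfold realBeta
  rw [Real.rpow_neg hy0.le, div_le_iff₀ hGxy, ← div_eq_mul_inv, div_mul_eq_mul_div,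
    le_div_iff₀ hyx]
  have h3 : Real.Gamma y * y ^ x ≤ 2 * Real.Gamma (x + y) := by nlinarith
  nlinarith
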